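/- arXiv:2202.12001 — 2 statements merged into one kernel-verified Lean document; each statement's English description precedes it below -/
import Mathlib

section
/- Let p be a prime and n ≥ 0 an integer. For all A, B ∈ GL₂(ℚ_p) the following are equivalent: (i) there exist λ ∈ ℚ_p^× and t ∈ Γ₀(p^n ℤ_p) such that A = λ · B · t; (ii) for every integer i with 0 ≤ i ≤ n there exist μ ∈ ℚ_p^× and k ∈ GL₂(ℤ_p) (a 2×2 matrix with entries in ℤ_p and determinant in ℤ_p^×) such that A · D_i = μ · B · D_i · k. (This expresses that the orbit map g ↦ g·g_n induces a well-defined bijection between GL₂(ℚ_p)/ℚ_p^× Γ₀(p^n ℤ_p) and the set of length-n geodesics on the Bruhat–Tits tree of PGL₂(ℚ_p) with origin-to-terminus vertex sequence g·D_0, …, g·D_n.) -/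
open Matrix

/-- The diagonal matrix `diag(1, p^i)` in `GL₂(ℚ_p)`. -/
noncomputable def Dmat (p : ℕ) [Fact p.Prime] (i : ℕ) : Matrix (Fin 2) (Fin 2) ℚ_[p] :=
  !![1, 0; 0, (p : ℚ_[p]) ^ i]

/-- A matrix over `ℚ_p` lies in `GL₂(ℤ_p)`: all entries are `p`-adic integers and the
determinant is a `p`-adic unit. -/
def IsGL2Zp (p : ℕ) [Fact p.Prime] (M : Matrix (Fin 2) (Fin 2) ℚ_[p]) : Prop :=
  (∀ i j, ‖M i j‖ ≤ 1) ∧ ‖M.det‖ = 1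

/-- A matrix over `ℚ_p` lies in `Γ₀(p^n ℤ_p)`: all entries in `ℤ_p`, determinant a unit,
and lower-left entry in `p^n ℤ_p`. -/
def Gamma0 (p : ℕ) [Fact p.Prime] (n : ℕ) (M : Matrix (Fin 2) (Fin 2) ℚ_[p]) : Prop :=
  (∀ i j, ‖M i j‖ ≤ 1) ∧ ‖M.det‖ = 1 ∧ ‖M 1 0‖ ≤ (p : ℝ) ^ (-(n : ℤ))

theorem det_Dmat (p : ℕ) [Fact p.Prime] (i : ℕ) : (Dmat p i).det = (p : ℚ_[p]) ^ i := by
  simp [Dmat, det_fin_two]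

theorem Dmat_zero (p : ℕ) [Fact p.Prime] : Dmat p 0 = 1 := by
  simp [Dmat, one_fin_two]

/-- For `i ≤ n`, conjugation by `Dmat p i` carries `Γ₀(p^n ℤ_p)` into `GL₂(ℤ_p)`. -/
theorem Gamma0.exists_mul_Dmat {p : ℕ} [Fact p.Prime] {n i : ℕ} (hi : i ≤ n)
    {t : Matrix (Fin 2) (Fin 2) ℚ_[p]} (ht : Gamma0 p n t) :
    ∃ k, IsGL2Zp p k ∧ t * Dmat p i = Dmat p i * k := by
  obtain ⟨hint, hdet, hlow⟩ := ht
  have hp : (p : ℚ_[p]) ≠ 0 := Nat.cast_ne_zero.mpr (Fact.out : p.Prime).ne_zero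
  have hpi : (p : ℚ_[p]) ^ i ≠ 0 := pow_ne_zero i hp
  have hp1 : (1 : ℝ) ≤ p := by exact_mod_cast (Fact.out : p.Prime).one_le
  have hpow : ‖(p : ℚ_[p]) ^ i‖ = (p : ℝ) ^ (-(i : ℤ)) := Padic.norm_p_pow i
  refine ⟨!![t 0 0, t 0 1 * (p : ℚ_[p]) ^ i; t 1 0 / (p : ℚ_[p]) ^ i, t 1 1], ⟨?_, ?_⟩, ?_⟩
  · have hupper : ‖t 0 1 * (p : ℚ_[p]) ^ i‖ ≤ 1 := by
      rw [norm_mul, hpow]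
      exact mul_le_one₀ (hint 0 1) (by positivity) (zpow_le_one_of_nonpos₀ hp1 (by omega))
    have hlower : ‖t 1 0 / (p : ℚ_[p]) ^ i‖ ≤ 1 := by
      rw [norm_div, hpow]
      exact div_le_one_of_le₀ (hlow.trans (zpow_le_zpow_right₀ hp1 (by omega))) (by positivity)
    intro r s
    fin_cases r <;> fin_cases s
    exacts [hint 0 0, hupper, hlower, hint 1 1]
  · rw [← hdet, det_fin_two, det_fin_two]
    congr 1
    simp only [of_apply, cons_val', cons_val_zero, cons_val_one, cons_val_fin_one]
    field_simp
  · ext r s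
    fin_cases r <;> fin_cases s <;> simp [Dmat, mul_apply, Fin.sum_univ_two] <;> field_simp

/-- An element of `GL₂(ℤ_p)` fixing the vertex `Dmat p n` lies in `Γ₀(p^n ℤ_p)`. -/
theorem IsGL2Zp.gamma0_of_smul_mul_Dmat {p : ℕ} [Fact p.Prime] {n : ℕ} {a b : ℚ_[p]}
    (ha : a ≠ 0) {t k : Matrix (Fin 2) (Fin 2) ℚ_[p]} (ht : IsGL2Zp p t) (hk : IsGL2Zp p k)
    (h : a • (t * Dmat p n) = b • (Dmat p n * k)) : Gamma0 p n t := by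
  refine ⟨ht.1, ht.2, ?_⟩
  have hp : (p : ℚ_[p]) ≠ 0 := Nat.cast_ne_zero.mpr (Fact.out : p.Prime).ne_zero
  have hpn : ‖(p : ℚ_[p]) ^ n‖ ≠ 0 := norm_ne_zero_iff.mpr (pow_ne_zero n hp)
  have hab : ‖a‖ = ‖b‖ := by
    have hdet := congrArg (fun M => ‖M.det‖) h
    simp only [det_smul, det_mul, det_Dmat, norm_mul, ht.2, hk.2, Fintype.card_fin, one_mul,
      mul_one] at hdet
    have hsq := mul_right_cancel₀ hpn hdet
    rw [norm_pow, norm_pow] at hsq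
    exact (pow_left_inj₀ (norm_nonneg a) (norm_nonneg b) two_ne_zero).mp hsq
  have hentry : a * t 1 0 = b * ((p : ℚ_[p]) ^ n * k 1 0) := by
    simpa [Dmat, mul_apply, Fin.sum_univ_two, vecMul, dotProduct] using congrFun (congrFun h 1) 0
  have hnorm := congrArg norm hentry
  rw [norm_mul, norm_mul, norm_mul, ← hab] at hnorm
  rw [mul_left_cancel₀ (norm_ne_zero_iff.mpr ha) hnorm, Padic.norm_p_pow]
  exact mul_le_of_le_one_right (by positivity) (hk.1 1 0)

/-- `A` and `B` represent the same class in
`GL₂(ℚ_p)/ℚ_p^× Γ₀(p^n ℤ_p)` if and only if for every `0 ≤ i ≤ n` the vertices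
`A·D_i` and `B·D_i` of the Bruhat–Tits tree coincide. -/
theorem orbit_map_bijection (p : ℕ) [Fact p.Prime] (n : ℕ)
    (A B : Matrix (Fin 2) (Fin 2) ℚ_[p]) (hA : A.det ≠ 0) (hB : B.det ≠ 0) :
    (∃ lam : ℚ_[p], lam ≠ 0 ∧ ∃ t : Matrix (Fin 2) (Fin 2) ℚ_[p],
        Gamma0 p n t ∧ A = lam • (B * t)) ↔
    (∀ i : ℕ, i ≤ n → ∃ mu : ℚ_[p], mu ≠ 0 ∧ ∃ k : Matrix (Fin 2) (Fin 2) ℚ_[p],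
        IsGL2Zp p k ∧ A * Dmat p i = mu • (B * Dmat p i * k)) := by
  constructor
  · rintro ⟨lam, hlam, t, ht, rfl⟩ i hi
    obtain ⟨k, hk, htk⟩ := ht.exists_mul_Dmat hi
    exact ⟨lam, hlam, k, hk, by rw [smul_mul, Matrix.mul_assoc, htk, Matrix.mul_assoc]⟩
  · intro h
    obtain ⟨lam, hlam, t, ht, hAt⟩ := h 0 n.zero_le
    rw [Dmat_zero, Matrix.mul_one, Matrix.mul_one] at hAt
    obtain ⟨mu, -, k, hk, hAk⟩ := h n le_rfl
    refine ⟨lam, hlam, t, ht.gamma0_of_smul_mul_Dmat hlam hk (b := mu) ?_, hAt⟩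
    have hBunit : IsUnit B := (isUnit_iff_isUnit_det B).mpr hB.isUnit
    apply hBunit.mul_left_cancel
    rw [Matrix.mul_smul, Matrix.mul_smul, ← Matrix.mul_assoc, ← Matrix.mul_assoc, ← hAk, hAt, smul_mul]
end

section
/- Let p be a prime and n ≥ 0 an integer. For every C ∈ GL₂(ℚ_p), the following are equivalent: (i) there exist λ, μ ∈ ℚ_p^× such that λ·C has entries in ℤ_p with determinant in ℤ_p^×, and μ·(D_n⁻¹ · C · D_n) has entries in ℤ_p with determinant in ℤ_p^×; (ii) there exists ν ∈ ℚ_p^× such that ν·C ∈ Γ₀(p^n ℤ_p). Equivalently, as subgroups of GL₂(ℚ_p): ℚ_p^× GL₂(ℤ_p) ∩ D_n · (ℚ_p^× GL₂(ℤ_p)) · D_n⁻¹ = ℚ_p^× Γ₀(p^n ℤ_p). (The stabilizer in PGL₂(ℚ_p) of the privileged length-n geodesic on the Bruhat–Tits tree is the image of Γ₀(p^n ℤ_p).) -/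
open Matrix

theorem Padic.p_pow_ne_zero (p : ℕ) [Fact p.Prime] (n : ℕ) : (p : ℚ_[p]) ^ n ≠ 0 :=
  pow_ne_zero _ (Nat.cast_ne_zero.2 (Fact.out : p.Prime).ne_zero)

theorem Dmat_inv_mul_mul_Dmat (p : ℕ) [Fact p.Prime] (n : ℕ) (C : Matrix (Fin 2) (Fin 2) ℚ_[p]) :
    (Dmat p n)⁻¹ * C * Dmat p n =
      !![C 0 0, C 0 1 * (p : ℚ_[p]) ^ n; C 1 0 / (p : ℚ_[p]) ^ n, C 1 1] := by
  have hp := Padic.p_pow_ne_zero p n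
  have hinv : (Dmat p n)⁻¹ = !![1, 0; 0, ((p : ℚ_[p]) ^ n)⁻¹] := by
    apply Matrix.inv_eq_right_inv
    ext i j
    fin_cases i <;> fin_cases j <;> simp [Dmat, hp]
  rw [hinv, Dmat]
  rw [Matrix.eta_fin_two C, Matrix.mul_fin_two, Matrix.mul_fin_two]
  ext i j
  fin_cases i <;> fin_cases j <;> simp [div_eq_inv_mul, mul_right_comm, hp]

theorem det_Dmat_inv_mul_mul_Dmat (p : ℕ) [Fact p.Prime] (n : ℕ)
    (C : Matrix (Fin 2) (Fin 2) ℚ_[p]) : ((Dmat p n)⁻¹ * C * Dmat p n).det = C.det := by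
  have hp := Padic.p_pow_ne_zero p n
  rw [Dmat_inv_mul_mul_Dmat, Matrix.det_fin_two_of, Matrix.det_fin_two]
  field_simp

theorem norm_eq_of_norm_det_smul_eq_one {p : ℕ} [Fact p.Prime]
    {A B : Matrix (Fin 2) (Fin 2) ℚ_[p]} (hdet : A.det = B.det) {a b : ℚ_[p]}
    (ha : ‖(a • A).det‖ = 1) (hb : ‖(b • B).det‖ = 1) : ‖a‖ = ‖b‖ := by
  simp only [Matrix.det_smul, Fintype.card_fin, norm_mul, norm_pow, hdet] at ha hb
  have hB : ‖B.det‖ ≠ 0 := right_ne_zero_of_mul (ha.trans_ne one_ne_zero)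
  exact (pow_left_inj₀ (norm_nonneg a) (norm_nonneg b) two_ne_zero).1
    (mul_right_cancel₀ hB (ha.trans hb.symm))

theorem norm_div_p_pow_le_one_iff {p : ℕ} [Fact p.Prime] (n : ℕ) (x : ℚ_[p]) :
    ‖x / (p : ℚ_[p]) ^ n‖ ≤ 1 ↔ ‖x‖ ≤ (p : ℝ) ^ (-(n : ℤ)) := by
  have hp : (0 : ℝ) < p := Nat.cast_pos.2 (Fact.out : p.Prime).pos
  rw [norm_div, Padic.norm_p_pow, div_le_one (zpow_pos hp _)]

/-- the stabilizer in `PGL₂(ℚ_p)` of the privileged length-`n` geodesic,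
i.e. `ℚ_p^× GL₂(ℤ_p) ∩ D_n (ℚ_p^× GL₂(ℤ_p)) D_n⁻¹`, equals `ℚ_p^× Γ₀(p^n ℤ_p)`. -/
theorem stabilizer_privileged_geodesic (p : ℕ) [Fact p.Prime] (n : ℕ)
    (C : Matrix (Fin 2) (Fin 2) ℚ_[p]) (hC : C.det ≠ 0) :
    ((∃ lam : ℚ_[p], lam ≠ 0 ∧ IsGL2Zp p (lam • C)) ∧
      (∃ mu : ℚ_[p], mu ≠ 0 ∧ IsGL2Zp p (mu • ((Dmat p n)⁻¹ * C * Dmat p n)))) ↔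
    (∃ nu : ℚ_[p], nu ≠ 0 ∧ Gamma0 p n (nu • C)) := by
  constructor
  · rintro ⟨⟨a, ha0, ha, hadet⟩, b, -, hb, hbdet⟩
    refine ⟨a, ha0, ha, hadet, ?_⟩
    have hab : ‖a‖ = ‖b‖ :=
      norm_eq_of_norm_det_smul_eq_one (det_Dmat_inv_mul_mul_Dmat p n C).symm hadet hbdet
    have h : ‖b * (C 1 0 / (p : ℚ_[p]) ^ n)‖ ≤ 1 := by
      simpa [Dmat_inv_mul_mul_Dmat] using hb 1 0
    rwa [norm_mul, ← hab, ← norm_mul, ← mul_div_assoc, norm_div_p_pow_le_one_iff] at h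
  · rintro ⟨a, ha0, ha, hadet, hlow⟩
    refine ⟨⟨a, ha0, ha, hadet⟩, a, ha0, fun i j => ?_, ?_⟩
    · have hpn : ‖(p : ℚ_[p]) ^ n‖ ≤ 1 := by
        rw [norm_pow]
        exact pow_le_one₀ (norm_nonneg _) Padic.norm_p_lt_one.le
      have hupper : ‖a * (C 0 1 * (p : ℚ_[p]) ^ n)‖ ≤ 1 := by
        rw [← mul_assoc, norm_mul]
        exact mul_le_one₀ (ha 0 1) (norm_nonneg _) hpn
      have hlower : ‖a * (C 1 0 / (p : ℚ_[p]) ^ n)‖ ≤ 1 := by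
        rw [← mul_div_assoc]
        exact (norm_div_p_pow_le_one_iff n _).2 hlow
      rw [Dmat_inv_mul_mul_Dmat]
      fin_cases i <;> fin_cases j
      exacts [ha 0 0, hupper, hlower, ha 1 1]
    · rwa [Matrix.det_smul, det_Dmat_inv_mul_mul_Dmat, ← Matrix.det_smul]
end
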